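/- arXiv:1406.4895 — 2 statements merged into one kernel-verified Lean document; each statement's English description precedes it below -/
import Mathlib

section
/- For any nonempty polytope P ⊆ ℝ^p there exists an extended formulation of size xc(P) whose feasible region is bounded; that is, there exist q ∈ ℕ, A ∈ ℝ^{xc(P)×q}, b ∈ ℝ^{xc(P)}, a linear equation system Cy = d, and a linear map π : ℝ^q → ℝ^p such that Q = {y ∈ ℝ^q : Ay ≤ b, Cy = d} is bounded (hence a polytope) and π(Q) = P. -/
/-- `P` admits an extended formulation with `m` inequalities (and finitely many
linear equations): a feasible region in some `ℝ^q` projecting linearly onto `P`. -/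
def IsExtFormulation {p : ℕ} (P : Set (Fin p → ℝ)) (m : ℕ) : Prop :=
  ∃ (q s : ℕ) (A : Matrix (Fin m) (Fin q) ℝ) (b : Fin m → ℝ)
    (C : Matrix (Fin s) (Fin q) ℝ) (d : Fin s → ℝ)
    (π : (Fin q → ℝ) →ₗ[ℝ] (Fin p → ℝ)),
    π '' {y | A.mulVec y ≤ b ∧ C.mulVec y = d} = P

/-- The extension complexity of `P`: the smallest number of inequalities in any
extended formulation for `P`. -/
noncomputable def xc {p : ℕ} (P : Set (Fin p → ℝ)) : ℕ :=
  sInf {m | IsExtFormulation P m}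

/-- A polytope is the convex hull of a finite set of points. -/
def IsPolytope {p : ℕ} (P : Set (Fin p → ℝ)) : Prop :=
  ∃ V : Finset (Fin p → ℝ), P = convexHull ℝ (V : Set (Fin p → ℝ))

open Matrix in
/-- The convex hull of finitely many points is a projection of a standard simplex. -/
lemma IsPolytope.exists_isExtFormulation {p : ℕ} {P : Set (Fin p → ℝ)} (hP : IsPolytope P) :
    ∃ m, IsExtFormulation P m := by
  obtain ⟨V, rfl⟩ := hP
  let v : Fin V.card → Fin p → ℝ := fun i => (V.equivFin.symm i : Fin p → ℝ)
  have hv : Set.range v = (V : Set (Fin p → ℝ)) := by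
    have : v = Subtype.val ∘ V.equivFin.symm := rfl
    rw [this, Set.range_comp, V.equivFin.symm.surjective.range_eq]
    simp
  refine ⟨V.card, V.card, 1, -1, 0, Matrix.of fun _ _ => 1, fun _ => 1,
    Fintype.linearCombination ℝ v, ?_⟩
  have hsimplex : {y : Fin V.card → ℝ | (-1 : Matrix (Fin V.card) (Fin V.card) ℝ) *ᵥ y ≤ 0 ∧
      (Matrix.of fun (_ : Fin 1) (_ : Fin V.card) => (1 : ℝ)) *ᵥ y = fun _ => 1} =
      stdSimplex ℝ (Fin V.card) := by
    ext y
    simp [stdSimplex, Matrix.neg_mulVec, Pi.le_def, funext_iff, Matrix.mulVec, dotProduct]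
  rw [hsimplex, ← convexHull_basis_eq_stdSimplex, LinearMap.image_convexHull, ← hv,
    ← Set.range_comp]
  congr 2
  ext i : 1
  simp [Fintype.linearCombination_apply, ite_smul]

open Matrix in
/-- A polyhedron whose recession cone is trivial is bounded. -/
lemma isBounded_polyhedron_of_recession_trivial {q : ℕ} {ι κ : Type*} [Fintype ι] [Fintype κ]
    (A : Matrix ι (Fin q) ℝ) (b : ι → ℝ) (C : Matrix κ (Fin q) ℝ) (d : κ → ℝ)
    (h : ∀ r, A *ᵥ r ≤ 0 → C *ᵥ r = 0 → r = 0) :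
    Bornology.IsBounded {y | A *ᵥ y ≤ b ∧ C *ᵥ y = d} := by
  let f : (Fin q → ℝ) → ℝ := fun y => ∑ i, max ((A *ᵥ y) i) 0 + ∑ j, |(C *ᵥ y) j|
  have hf : Continuous f := by fun_prop
  have hpos : ∀ y ∈ Metric.sphere (0 : Fin q → ℝ) 1, 0 < f y := by
    intro y hy
    have h1 : 0 ≤ ∑ i, max ((A *ᵥ y) i) 0 := Finset.sum_nonneg fun _ _ => le_max_right _ _
    have h2 : 0 ≤ ∑ j, |(C *ᵥ y) j| := Finset.sum_nonneg fun _ _ => abs_nonneg _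
    refine (add_nonneg h1 h2).lt_of_ne fun h0 => ?_
    obtain ⟨e1, e2⟩ := (add_eq_zero_iff_of_nonneg h1 h2).1 h0.symm
    rw [Finset.sum_eq_zero_iff_of_nonneg fun _ _ => le_max_right _ _] at e1
    rw [Finset.sum_eq_zero_iff_of_nonneg fun _ _ => abs_nonneg _] at e2
    have := h y (fun i => max_eq_right_iff.1 (e1 i (Finset.mem_univ _)))
      (funext fun j => abs_eq_zero.1 (e2 j (Finset.mem_univ _)))
    simp [this] at hy
  obtain ⟨ε, hε, hle⟩ := (isCompact_sphere (0 : Fin q → ℝ) 1).exists_forall_le' hf.continuousOn hpos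
  have hhom : ∀ (c : ℝ) y, 0 ≤ c → f (c • y) = c * f y := by
    intro c y hc
    simp [f, Matrix.mulVec_smul, abs_mul, abs_of_nonneg hc, mul_add, Finset.mul_sum,
      mul_max_of_nonneg _ _ hc]
  rw [isBounded_iff_forall_norm_le]
  refine ⟨(∑ i, |b i| + ∑ j, |d j|) / ε, fun y hy => ?_⟩
  rw [le_div_iff₀ hε]
  have hfy : f y ≤ ∑ i, |b i| + ∑ j, |d j| := by
    simp only [f, hy.2]
    gcongr with i
    exact max_le ((hy.1 i).trans (le_abs_self _)) (abs_nonneg _)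
  refine le_trans ?_ hfy
  rcases eq_or_ne y 0 with rfl | hy0
  · simp [f]
  · have hn : 0 < ‖y‖ := norm_pos_iff.2 hy0
    calc ‖y‖ * ε ≤ ‖y‖ * f (‖y‖⁻¹ • y) := by
          gcongr
          apply hle
          simp [norm_smul, hn.ne']
      _ = f y := by rw [← hhom _ _ hn.le, smul_inv_smul₀ hn.ne']

open Matrix in
/-- A linear map with bounded image of a nonempty polyhedron vanishes on its recession cone. -/
lemma map_recession_eq_zero {p q : ℕ} {ι κ : Type*}
    {A : Matrix ι (Fin q) ℝ} {b : ι → ℝ} {C : Matrix κ (Fin q) ℝ} {d : κ → ℝ}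
    {π : (Fin q → ℝ) →ₗ[ℝ] (Fin p → ℝ)}
    (hb : Bornology.IsBounded (π '' {y | A *ᵥ y ≤ b ∧ C *ᵥ y = d}))
    (hne : {y | A *ᵥ y ≤ b ∧ C *ᵥ y = d}.Nonempty)
    {r : Fin q → ℝ} (hA : A *ᵥ r ≤ 0) (hC : C *ᵥ r = 0) : π r = 0 := by
  obtain ⟨y, hyA, hyC⟩ := hne
  obtain ⟨M, hM⟩ := isBounded_iff_forall_norm_le.1 hb
  by_contra hr
  have hn : 0 < ‖π r‖ := norm_pos_iff.2 hr
  obtain ⟨n, hlt⟩ := exists_nat_gt ((M + ‖π y‖) / ‖π r‖)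
  rw [div_lt_iff₀ hn] at hlt
  have hmem : y + (n : ℝ) • r ∈ {y | A *ᵥ y ≤ b ∧ C *ᵥ y = d} := by
    refine ⟨?_, by simp [Matrix.mulVec_add, Matrix.mulVec_smul, hC, hyC]⟩
    rw [Matrix.mulVec_add, Matrix.mulVec_smul]
    exact (add_le_of_nonpos_right (smul_nonpos_of_nonneg_of_nonpos n.cast_nonneg hA)).trans hyA
  have h1 := hM _ (Set.mem_image_of_mem π hmem)
  have h2 : (n : ℝ) * ‖π r‖ ≤ ‖π (y + (n : ℝ) • r)‖ + ‖π y‖ := by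
    calc (n : ℝ) * ‖π r‖ = ‖π (y + (n : ℝ) • r) - π y‖ := by simp [norm_smul]
      _ ≤ _ := norm_sub_le _ _
  linarith

open Matrix in
/-- Inequalities that become strictly slack along a recession direction in the kernel of the
projection can be dropped from an extended formulation. -/
lemma IsExtFormulation.drop_slack {p q s : ℕ} {ι : Type*} [Fintype ι]
    (A : Matrix ι (Fin q) ℝ) (b : ι → ℝ) (C : Matrix (Fin s) (Fin q) ℝ) (d : Fin s → ℝ)
    (π : (Fin q → ℝ) →ₗ[ℝ] (Fin p → ℝ))
    {r : Fin q → ℝ} (hA : A *ᵥ r ≤ 0) (hC : C *ᵥ r = 0) (hπ : π r = 0) :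
    IsExtFormulation (π '' {y | A *ᵥ y ≤ b ∧ C *ᵥ y = d})
      (Nat.card {i // (A *ᵥ r) i = 0}) := by
  let e := Finite.equivFin {i // (A *ᵥ r) i = 0}
  refine ⟨q, s, A.submatrix (fun k => (e.symm k : ι)) id, fun k => b (e.symm k), C, d, π, ?_⟩
  apply Set.Subset.antisymm
  · rintro _ ⟨y, ⟨hyA, hyC⟩, rfl⟩
    have hyA' : ∀ i, (A *ᵥ r) i = 0 → (A *ᵥ y) i ≤ b i := by
      intro i hi
      have h : (A *ᵥ y) (e.symm (e ⟨i, hi⟩)) ≤ b (e.symm (e ⟨i, hi⟩)) := hyA (e ⟨i, hi⟩)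
      rwa [e.symm_apply_apply] at h
    let t : ι → ℝ := fun i => |((A *ᵥ y) i - b i) / (A *ᵥ r) i|
    have ht : ∀ i, 0 ≤ t i := fun i => abs_nonneg _
    refine ⟨y + (∑ i, t i) • r, ⟨fun i => ?_, ?_⟩, by simp [hπ]⟩
    · simp only [Matrix.mulVec_add, Matrix.mulVec_smul, Pi.add_apply, Pi.smul_apply, smul_eq_mul]
      rcases (hA i).lt_or_eq with hi | hi
      · have hi' : (A *ᵥ r) i < 0 := hi
        have h1 : t i ≤ ∑ i, t i := Finset.single_le_sum (fun i _ => ht i) (Finset.mem_univ i)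
        have h2 : -(t i) ≤ ((A *ᵥ y) i - b i) / (A *ᵥ r) i := neg_abs_le _
        rw [le_div_iff_of_neg hi'] at h2
        nlinarith [mul_le_mul_of_nonpos_right h1 hi'.le]
      · have hi' : (A *ᵥ r) i = 0 := hi
        simpa [hi'] using hyA' i hi'
    · simp [Matrix.mulVec_add, Matrix.mulVec_smul, hC, hyC]
  · refine Set.image_mono fun y hy => ⟨fun k => ?_, hy.2⟩
    exact hy.1 (e.symm k)

/-- Every nonempty polytope has a minimum size extended
formulation whose feasible region is bounded (hence a polytope). -/
theorem stmt2 {p : ℕ} (P : Set (Fin p → ℝ)) (hpoly : IsPolytope P) (hne : P.Nonempty) :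
    ∃ (q s : ℕ) (A : Matrix (Fin (xc P)) (Fin q) ℝ) (b : Fin (xc P) → ℝ)
      (C : Matrix (Fin s) (Fin q) ℝ) (d : Fin s → ℝ)
      (π : (Fin q → ℝ) →ₗ[ℝ] (Fin p → ℝ)),
      Bornology.IsBounded {y | A.mulVec y ≤ b ∧ C.mulVec y = d} ∧
      π '' {y | A.mulVec y ≤ b ∧ C.mulVec y = d} = P := by
  have hmin : IsExtFormulation P (xc P) := Nat.sInf_mem hpoly.exists_isExtFormulation
  have hbdd : Bornology.IsBounded P := by
    obtain ⟨V, rfl⟩ := hpoly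
    exact isBounded_convexHull.2 V.finite_toSet.isBounded
  obtain ⟨q, s, A, b, C, d, π, hP⟩ := hmin
  have hQne : {y | A.mulVec y ≤ b ∧ C.mulVec y = d}.Nonempty := by
    rwa [← hP, Set.image_nonempty] at hne
  have hker : ∀ r, A.mulVec r ≤ 0 → C.mulVec r = 0 → π r = 0 := fun r hA hC =>
    map_recession_eq_zero (by rwa [hP]) hQne hA hC
  have hlin : ∀ r, A.mulVec r ≤ 0 → C.mulVec r = 0 → A.mulVec r = 0 := by
    intro r hA hC
    by_contra hr
    obtain ⟨i, hi⟩ := Function.ne_iff.1 hr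
    have hlt : Nat.card {i // A.mulVec r i = 0} < xc P := by
      simpa [Nat.card_eq_fintype_card] using
        Fintype.card_subtype_lt (p := fun i => A.mulVec r i = 0) hi
    have hdrop := IsExtFormulation.drop_slack A b C d π hA hC (hker r hA hC)
    rw [hP] at hdrop
    exact (Nat.sInf_le hdrop).not_gt hlt
  let L : Submodule ℝ (Fin q → ℝ) := LinearMap.ker A.mulVecLin ⊓ LinearMap.ker C.mulVecLin
  have hL : ∀ {x}, x ∈ L ↔ A.mulVec x = 0 ∧ C.mulVec x = 0 := by simp [L]
  obtain ⟨g, hg⟩ := L.subtype.exists_leftInverse_of_injective L.ker_subtype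
  have hgL : ∀ x : L, g x = x := fun x => LinearMap.congr_fun hg x
  let D : Matrix (Fin q) (Fin q) ℝ := LinearMap.toMatrix' (L.subtype ∘ₗ g)
  have hD : ∀ y, D.mulVec y = g y := fun y => by simp [D, LinearMap.toMatrix'_mulVec]
  have happ : ∀ y c, Matrix.mulVec (Matrix.of (Fin.append C D)) y = Fin.append c 0 ↔
      C.mulVec y = c ∧ g y = 0 := by
    intro y c
    rw [← Submodule.coe_eq_zero, ← hD]
    have hleft : ∀ i, (fun j => Fin.append C D (Fin.castAdd q i) j) = C i := fun i =>
      Fin.append_left _ _ i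
    have hright : ∀ i, (fun j => Fin.append C D (Fin.natAdd s i) j) = D i := fun i =>
      Fin.append_right _ _ i
    simp [funext_iff, Fin.forall_fin_add, Matrix.mulVec, hleft, hright]
  refine ⟨q, s + q, A, b, Matrix.of (Fin.append C D), Fin.append d 0, π, ?_, ?_⟩
  · apply isBounded_polyhedron_of_recession_trivial
    intro r hA hCD
    obtain ⟨hC, hgr⟩ := (happ r 0).1 (by rw [hCD]; ext i; refine Fin.addCases ?_ ?_ i <;> simp)
    have hgr' := hgL ⟨r, hL.2 ⟨hlin r hA hC, hC⟩⟩
    rw [hgr] at hgr'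
    exact (congrArg Subtype.val hgr').symm
  · simp only [happ]
    refine Set.Subset.antisymm ?_ ?_
    · refine Set.Subset.trans ?_ hP.subset
      exact Set.image_mono fun y hy => ⟨hy.1, hy.2.1⟩
    · refine hP.symm.subset.trans ?_
      rintro _ ⟨y, ⟨hyA, hyC⟩, rfl⟩
      obtain ⟨hA, hC⟩ := hL.1 (g y).2
      refine ⟨y - g y, ⟨?_, ?_, ?_⟩, ?_⟩
      · simpa [Matrix.mulVec_sub, hA] using hyA
      · simpa [Matrix.mulVec_sub, hC] using hyC
      · simp [hgL]
      · simp [hker _ hA.le hC]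
end

section
/- Let P_1, …, P_k ⊆ ℝ^p be pairwise disjoint nonempty 0/1-polytopes. Then xcs(conv(P_1 ∪ ⋯ ∪ P_k)) ≤ Σ_{i=1}^k xcs(P_i) + |{i ∈ {1,…,k} : P_i is a singleton}|. -/
/-- A 0/1-vector. -/
def IsZeroOneVec {ι : Type*} (x : ι → ℝ) : Prop := ∀ i, x i = 0 ∨ x i = 1

/-- A 0/1-polytope: the convex hull of a set of 0/1-vectors. -/
def IsZeroOnePolytope {ι : Type*} (Q : Set (ι → ℝ)) : Prop :=
  ∃ V : Set (ι → ℝ), (∀ x ∈ V, IsZeroOneVec x) ∧ Q = convexHull ℝ V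

/-- `(Q, π)` is a nice 0/1-extension of `P`: `Q` is a 0/1-polytope, `π(Q) = P`,
every vertex (extreme point) of `Q` projects to a vertex of `P`, and each vertex
of `P` has exactly one vertex of `Q` projecting onto it. -/
def IsNiceExtension {p : ℕ} {ι : Type*} (P : Set (Fin p → ℝ)) (Q : Set (ι → ℝ))
    (π : (ι → ℝ) →ₗ[ℝ] (Fin p → ℝ)) : Prop :=
  IsZeroOnePolytope Q ∧ π '' Q = P ∧
    (∀ y ∈ Set.extremePoints ℝ Q, π y ∈ Set.extremePoints ℝ P) ∧
    (∀ v ∈ Set.extremePoints ℝ P, ∃! y, y ∈ Set.extremePoints ℝ Q ∧ π y = v)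

/-- `P` has a nice 0/1-extension `(Q, π)` where `Q` is described by `m` linear
inequalities together with finitely many linear equations. -/
def HasNiceDescrOfSize {p : ℕ} (P : Set (Fin p → ℝ)) (m : ℕ) : Prop :=
  ∃ (q s : ℕ) (A : Matrix (Fin m) (Fin q) ℝ) (b : Fin m → ℝ)
    (C : Matrix (Fin s) (Fin q) ℝ) (d : Fin s → ℝ)
    (π : (Fin q → ℝ) →ₗ[ℝ] (Fin p → ℝ)),
    IsNiceExtension P {y | A.mulVec y ≤ b ∧ C.mulVec y = d} π

/-- The smallest size of a description of `Q` over all nice 0/1-extensions `(Q, π)` of `P`. -/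
noncomputable def xcs {p : ℕ} (P : Set (Fin p → ℝ)) : ℕ :=
  sInf {m | HasNiceDescrOfSize P m}

lemma IsZeroOneVec.mem_Icc {ι : Type*} {x : ι → ℝ} (hx : IsZeroOneVec x) :
    x ∈ Set.Icc (0 : ι → ℝ) 1 := by
  constructor <;> intro i <;> rcases hx i with h | h <;> simp [h]

lemma IsZeroOneVec.mem_extremePoints_Icc {ι : Type*} {x : ι → ℝ} (hx : IsZeroOneVec x) :
    x ∈ Set.extremePoints ℝ (Set.Icc (0 : ι → ℝ) 1) := by
  refine mem_extremePoints.2 ⟨hx.mem_Icc, ?_⟩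
  rintro y hy z hz ⟨a, b, ha, hb, hab, rfl⟩
  have key : ∀ i, y i = (a • y + b • z) i ∧ z i = (a • y + b • z) i := by
    intro i
    have hy0 := hy.1 i
    have hy1 := hy.2 i
    have hz0 := hz.1 i
    have hz1 := hz.2 i
    have hxi := hx i
    simp only [Pi.add_apply, Pi.smul_apply, smul_eq_mul, Pi.zero_apply, Pi.one_apply] at *
    rcases hxi with h | h <;> rw [h] <;> constructor <;> nlinarith
  exact ⟨funext fun i => (key i).1, funext fun i => (key i).2⟩

lemma convexHull_subset_Icc_of_isZeroOneVec {ι : Type*} {V : Set (ι → ℝ)}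
    (hV : ∀ x ∈ V, IsZeroOneVec x) : convexHull ℝ V ⊆ Set.Icc (0 : ι → ℝ) 1 :=
  convexHull_min (fun x hx => (hV x hx).mem_Icc) (convex_Icc _ _)

lemma extremePoints_convexHull_of_isZeroOneVec {ι : Type*} {V : Set (ι → ℝ)}
    (hV : ∀ x ∈ V, IsZeroOneVec x) : Set.extremePoints ℝ (convexHull ℝ V) = V := by
  refine Set.Subset.antisymm extremePoints_convexHull_subset fun x hx => ?_
  exact inter_extremePoints_subset_extremePoints_of_subset
    (convexHull_subset_Icc_of_isZeroOneVec hV)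
    ⟨subset_convexHull ℝ V hx, (hV x hx).mem_extremePoints_Icc⟩

lemma isNiceExtension_convexHull_iff {p : ℕ} {ι : Type*} {V : Set (Fin p → ℝ)}
    {W : Set (ι → ℝ)} (hV : ∀ x ∈ V, IsZeroOneVec x) (hW : ∀ x ∈ W, IsZeroOneVec x)
    (π : (ι → ℝ) →ₗ[ℝ] (Fin p → ℝ)) :
    IsNiceExtension (convexHull ℝ V) (convexHull ℝ W) π ↔ Set.BijOn π W V := by
  unfold IsNiceExtension
  rw [extremePoints_convexHull_of_isZeroOneVec hV, extremePoints_convexHull_of_isZeroOneVec hW]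
  constructor
  · rintro ⟨-, -, hmaps, huniq⟩
    refine ⟨hmaps, fun x hx y hy hxy => ?_, fun v hv => (huniq v hv).exists⟩
    exact (huniq _ (hmaps y hy)).unique ⟨hx, hxy⟩ ⟨hy, rfl⟩
  · rintro ⟨hmaps, hinj, hsurj⟩
    refine ⟨⟨W, hW, rfl⟩, ?_, hmaps, fun v hv => ?_⟩
    · rw [LinearMap.image_convexHull, hsurj.image_eq_of_mapsTo hmaps]
    · obtain ⟨w, hw, rfl⟩ := hsurj hv
      exact ⟨w, ⟨hw, rfl⟩, fun y hy => hinj hy.1 hw hy.2⟩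

lemma HasNiceDescrOfSize.of_functionals {p : ℕ} {ι σ τ : Type} [Fintype ι] [Fintype σ]
    [Fintype τ] (f : σ → (ι → ℝ) →ₗ[ℝ] ℝ) (b : σ → ℝ) (g : τ → (ι → ℝ) →ₗ[ℝ] ℝ) (d : τ → ℝ)
    (π : (ι → ℝ) →ₗ[ℝ] (Fin p → ℝ)) {V : Set (Fin p → ℝ)} {W : Set (ι → ℝ)}
    (hV : ∀ x ∈ V, IsZeroOneVec x) (hW : ∀ x ∈ W, IsZeroOneVec x)
    (hQ : {y | (∀ s, f s y ≤ b s) ∧ ∀ t, g t y = d t} = convexHull ℝ W)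
    (hπ : Set.BijOn π W V) : HasNiceDescrOfSize (convexHull ℝ V) (Fintype.card σ) := by
  let eι := Fintype.equivFin ι
  let eσ := Fintype.equivFin σ
  let eτ := Fintype.equivFin τ
  let T : (Fin (Fintype.card ι) → ℝ) ≃ₗ[ℝ] (ι → ℝ) := LinearEquiv.funCongrLeft ℝ ℝ eι
  have hW' : ∀ x ∈ T.symm '' W, IsZeroOneVec x := by
    rintro _ ⟨w, hw, rfl⟩ i
    exact hW w hw (eι.symm i)
  refine ⟨Fintype.card ι, Fintype.card τ,
    LinearMap.toMatrix' (LinearMap.pi fun s => f (eσ.symm s) ∘ₗ T.toLinearMap),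
    fun s => b (eσ.symm s),
    LinearMap.toMatrix' (LinearMap.pi fun t => g (eτ.symm t) ∘ₗ T.toLinearMap),
    fun t => d (eτ.symm t), π ∘ₗ T.toLinearMap, ?_⟩
  have hset : {y | (LinearMap.toMatrix'
        (LinearMap.pi fun s => f (eσ.symm s) ∘ₗ T.toLinearMap)).mulVec y ≤
          (fun s => b (eσ.symm s)) ∧
      (LinearMap.toMatrix' (LinearMap.pi fun t => g (eτ.symm t) ∘ₗ T.toLinearMap)).mulVec y =
          fun t => d (eτ.symm t)} = convexHull ℝ (T.symm '' W) := by
    have himg : convexHull ℝ (T.symm '' W) = T.symm '' convexHull ℝ W :=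
      (LinearMap.image_convexHull T.symm.toLinearMap W).symm
    rw [himg, ← hQ]
    ext y
    simp only [LinearMap.toMatrix'_mulVec, Set.mem_ofPred_eq, Pi.le_def, funext_iff,
      LinearMap.pi_apply, LinearMap.comp_apply, LinearEquiv.coe_coe, Set.mem_image]
    constructor
    · rintro ⟨h1, h2⟩
      refine ⟨T y, ⟨fun s => ?_, fun t => ?_⟩, fun i => by rw [T.symm_apply_apply]⟩
      · simpa using h1 (eσ s)
      · simpa using h2 (eτ t)
    · rintro ⟨z, ⟨h1, h2⟩, hz⟩
      obtain rfl : T.symm z = y := funext hz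
      simp only [LinearEquiv.apply_symm_apply]
      exact ⟨fun s => h1 _, fun t => h2 _⟩
  rw [hset, isNiceExtension_convexHull_iff hV hW']
  refine hπ.comp ?_
  refine ⟨?_, T.injective.injOn, fun w hw => ⟨T.symm w, ⟨w, hw, rfl⟩, by simp⟩⟩
  rintro _ ⟨w, hw, rfl⟩
  simpa using hw

lemma finite_of_forall_isZeroOneVec {ι : Type*} [Finite ι] {V : Set (ι → ℝ)}
    (hV : ∀ x ∈ V, IsZeroOneVec x) : V.Finite :=
  (Set.Finite.pi' fun _ : ι => Set.toFinite ({0, 1} : Set ℝ)).subset fun x hx i => hV x hx i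

/-- Every 0/1-polytope is a projection of a simplex with the same vertices. -/
lemma HasNiceDescrOfSize.of_simplex {p : ℕ} {V : Set (Fin p → ℝ)}
    (hV : ∀ x ∈ V, IsZeroOneVec x) : HasNiceDescrOfSize (convexHull ℝ V) V.ncard := by
  classical
  have : Fintype V := (finite_of_forall_isZeroOneVec hV).fintype
  rw [← Nat.card_coe_set_eq, Nat.card_eq_fintype_card]
  refine HasNiceDescrOfSize.of_functionals (ι := V) (σ := V) (τ := Unit)
    (fun v => -LinearMap.proj v) 0 (fun _ => ∑ v, LinearMap.proj v) 1
    (Fintype.linearCombination ℝ (Subtype.val : V → Fin p → ℝ))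
    (W := Set.range fun v : V => Pi.single v (1 : ℝ)) hV ?_ ?_ ?_
  · rintro _ ⟨v, rfl⟩ w
    by_cases h : w = v
    · subst h; simp
    · simp [h]
  · rw [convexHull_rangle_single_eq_stdSimplex]
    ext y
    simp [stdSimplex]
  · refine ⟨?_, ?_, fun v hv => ⟨Pi.single ⟨v, hv⟩ 1, ⟨⟨v, hv⟩, rfl⟩, ?_⟩⟩
    · rintro _ ⟨v, rfl⟩
      simp
    · rintro _ ⟨v, rfl⟩ _ ⟨w, rfl⟩ h
      have : v = w := by simpa [Subtype.ext_iff] using h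
      rw [this]
    · simp

lemma IsZeroOnePolytope.hasNiceDescrOfSize_xcs {p : ℕ} {P : Set (Fin p → ℝ)}
    (hP : IsZeroOnePolytope P) : HasNiceDescrOfSize P (xcs P) := by
  obtain ⟨V, hV, rfl⟩ := hP
  exact Nat.sInf_mem (s := {m | HasNiceDescrOfSize (convexHull ℝ V) m})
    ⟨_, HasNiceDescrOfSize.of_simplex hV⟩

/-- The recession cone of a nonempty polyhedron contained in the unit cube is trivial. -/
lemma eq_zero_of_mulVec_nonpos {m q s : ℕ} {A : Matrix (Fin m) (Fin q) ℝ} {b : Fin m → ℝ}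
    {C : Matrix (Fin s) (Fin q) ℝ} {d : Fin s → ℝ}
    (hQ : {y | A.mulVec y ≤ b ∧ C.mulVec y = d} ⊆ Set.Icc 0 1) {z y : Fin q → ℝ}
    (hz : A.mulVec z ≤ b ∧ C.mulVec z = d) (hAy : A.mulVec y ≤ 0) (hCy : C.mulVec y = 0) :
    y = 0 := by
  have hray : ∀ t : ℝ, 0 ≤ t → z + t • y ∈ Set.Icc (0 : Fin q → ℝ) 1 := by
    intro t ht
    refine hQ ⟨?_, ?_⟩
    · rw [Matrix.mulVec_add, Matrix.mulVec_smul]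
      have := smul_nonpos_of_nonneg_of_nonpos ht hAy
      simpa using add_le_add hz.1 this
    · rw [Matrix.mulVec_add, Matrix.mulVec_smul, hCy, hz.2]
      simp
  funext i
  by_contra hi
  replace hi : y i ≠ 0 := hi
  have hi' : 0 < |y i| := abs_pos.2 hi
  have ht : 0 ≤ 2 / |y i| := by positivity
  have h0 := hray 0 le_rfl
  have h0l := h0.1 i
  have h0u := h0.2 i
  have hl := (hray _ ht).1 i
  have hu := (hray _ ht).2 i
  simp only [Pi.add_apply, Pi.smul_apply, smul_eq_mul, Pi.zero_apply, Pi.one_apply, zero_mul,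
    add_zero] at h0l h0u hl hu
  rcases abs_cases (y i) with ⟨h, -⟩ | ⟨h, -⟩
  · rw [h] at hu
    have : 2 / y i * y i = 2 := div_mul_cancel₀ _ hi
    linarith
  · rw [h] at hl
    have : 2 / -y i * y i = -2 := by rw [div_neg, neg_mul, div_mul_cancel₀ _ hi]
    linarith

/-- A nontrivial polyhedron contained in the unit cube has no homogenized point of negative
height. -/
lemma nonneg_of_mulVec_le_smul {m q s : ℕ} {A : Matrix (Fin m) (Fin q) ℝ} {b : Fin m → ℝ}
    {C : Matrix (Fin s) (Fin q) ℝ} {d : Fin s → ℝ}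
    (hQ : {y | A.mulVec y ≤ b ∧ C.mulVec y = d} ⊆ Set.Icc 0 1)
    (hnt : {y | A.mulVec y ≤ b ∧ C.mulVec y = d}.Nontrivial) {y : Fin q → ℝ} {t : ℝ}
    (hA : A.mulVec y ≤ t • b) (hC : C.mulVec y = t • d) : 0 ≤ t := by
  by_contra! ht
  obtain ⟨z, hz, w, hw, hzw⟩ := hnt
  have key : ∀ v, (A.mulVec v ≤ b ∧ C.mulVec v = d) → y - t • v = 0 := by
    intro v hv
    refine eq_zero_of_mulVec_nonpos hQ hz ?_ ?_
    · rw [Matrix.mulVec_sub, Matrix.mulVec_smul]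
      have := smul_le_smul_of_nonpos_left hv.1 ht.le
      exact sub_nonpos.2 (hA.trans this)
    · rw [Matrix.mulVec_sub, Matrix.mulVec_smul, hC, hv.2, sub_self]
  have hz' := sub_eq_zero.1 (key z hz)
  have hw' := sub_eq_zero.1 (key w hw)
  exact hzw (smul_right_injective _ ht.ne (hz'.symm.trans hw'))

/-- The embedding of the `i`-th block, at height one, into the homogenized product. -/
noncomputable def blockEmbed {k : ℕ} {q : Fin k → ℕ} (i : Fin k) (w : Fin (q i) → ℝ) :
    (Σ i, Option (Fin (q i))) → ℝ :=
  fun x => (Pi.single i (fun o => o.elim 1 w) : ∀ i, Option (Fin (q i)) → ℝ) x.1 x.2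

section blockEmbed

variable {k : ℕ} {q : Fin k → ℕ}

lemma blockEmbed_self (i : Fin k) (w : Fin (q i) → ℝ) (o : Option (Fin (q i))) :
    blockEmbed i w ⟨i, o⟩ = o.elim 1 w := by
  simp [blockEmbed]

lemma blockEmbed_of_ne {i j : Fin k} (h : j ≠ i) (w : Fin (q i) → ℝ) (o : Option (Fin (q j))) :
    blockEmbed i w ⟨j, o⟩ = 0 := by
  simp [blockEmbed, h]

lemma isZeroOneVec_blockEmbed {i : Fin k} {w : Fin (q i) → ℝ} (hw : IsZeroOneVec w) :
    IsZeroOneVec (blockEmbed i w) := by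
  rintro ⟨j, o⟩
  by_cases h : j = i
  · subst h
    rw [blockEmbed_self]
    cases o with
    | none => simp
    | some a => exact hw a
  · exact Or.inl (blockEmbed_of_ne h w o)

lemma blockEmbed_convexCombo (i : Fin k) (v w : Fin (q i) → ℝ) {a b : ℝ} (hab : a + b = 1) :
    blockEmbed i (a • v + b • w) = a • blockEmbed i v + b • blockEmbed i w := by
  funext ⟨j, o⟩
  simp only [Pi.add_apply, Pi.smul_apply]
  by_cases h : j = i
  · subst h
    simp only [blockEmbed_self]
    cases o <;> simp [hab]
  · simp [blockEmbed_of_ne h]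

lemma blockEmbed_mem_convexHull {W : ∀ i, Set (Fin (q i) → ℝ)} {i : Fin k}
    {w : Fin (q i) → ℝ} (hw : w ∈ convexHull ℝ (W i)) :
    blockEmbed i w ∈ convexHull ℝ (⋃ i, blockEmbed i '' W i) := by
  have hsub : convexHull ℝ (W i) ⊆
      {v | blockEmbed i v ∈ convexHull ℝ (⋃ i, blockEmbed i '' W i)} := by
    refine convexHull_min (fun v hv => subset_convexHull ℝ _
      (Set.mem_iUnion.2 ⟨i, v, hv, rfl⟩)) ?_
    intro v hv u hu a b ha hb hab
    rw [Set.mem_ofPred_eq, blockEmbed_convexCombo i v u hab]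
    exact convex_convexHull ℝ _ hv hu ha hb hab
  exact hsub hw

/-- The projection of the homogenized product onto its `i`-th block. -/
def blockProj (i : Fin k) : ((Σ i, Option (Fin (q i))) → ℝ) →ₗ[ℝ] (Fin (q i) → ℝ) :=
  LinearMap.funLeft ℝ ℝ fun a => ⟨i, some a⟩

lemma blockProj_blockEmbed_self (i : Fin k) (w : Fin (q i) → ℝ) :
    blockProj i (blockEmbed i w) = w := by
  funext a
  simp [blockProj, LinearMap.funLeft_apply, blockEmbed_self]

lemma blockProj_blockEmbed_of_ne {i j : Fin k} (h : j ≠ i) (w : Fin (q i) → ℝ) :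
    blockProj j (blockEmbed i w) = 0 := by
  funext a
  simp [blockProj, LinearMap.funLeft_apply, blockEmbed_of_ne h]

lemma eq_sum_smul_blockEmbed (y : (Σ i, Option (Fin (q i))) → ℝ) (z : ∀ i, Fin (q i) → ℝ)
    (hz : ∀ i, blockProj i y = y ⟨i, none⟩ • z i) :
    y = ∑ i, y ⟨i, none⟩ • blockEmbed i (z i) := by
  funext ⟨j, o⟩
  rw [Finset.sum_apply, Finset.sum_eq_single j]
  · rw [Pi.smul_apply, blockEmbed_self]
    cases o with
    | none => simp
    | some a => exact congrFun (hz j) a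
  · intro i _ hij
    rw [Pi.smul_apply, blockEmbed_of_ne hij.symm, smul_zero]
  · simp

end blockEmbed

/-- Balas' disjunctive formulation: a polyhedral description of the convex hull of the blocks,
where nonnegativity of the multiplier is only imposed for the indices in `S`. -/
lemma disjunctive_description {k : ℕ} {m q s : Fin k → ℕ}
    {A : ∀ i, Matrix (Fin (m i)) (Fin (q i)) ℝ} {b : ∀ i, Fin (m i) → ℝ}
    {C : ∀ i, Matrix (Fin (s i)) (Fin (q i)) ℝ} {d : ∀ i, Fin (s i) → ℝ}
    {W : ∀ i, Set (Fin (q i) → ℝ)} (hW : ∀ i, ∀ w ∈ W i, IsZeroOneVec w)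
    (hne : ∀ i, (W i).Nonempty)
    (hQ : ∀ i, {y | (A i).mulVec y ≤ b i ∧ (C i).mulVec y = d i} = convexHull ℝ (W i))
    (S : Set (Fin k)) (hS : ∀ i ∉ S, (convexHull ℝ (W i)).Nontrivial)
    (y : (Σ i, Option (Fin (q i))) → ℝ) :
    ((∀ i, (A i).mulVec (blockProj i y) ≤ y ⟨i, none⟩ • b i) ∧ (∀ i ∈ S, 0 ≤ y ⟨i, none⟩) ∧
      (∀ i, (C i).mulVec (blockProj i y) = y ⟨i, none⟩ • d i) ∧ ∑ i, y ⟨i, none⟩ = 1) ↔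
    y ∈ convexHull ℝ (⋃ i, blockEmbed i '' W i) := by
  have hbox : ∀ i, {y | (A i).mulVec y ≤ b i ∧ (C i).mulVec y = d i} ⊆ Set.Icc 0 1 := fun i =>
    (hQ i).trans_subset (convexHull_subset_Icc_of_isZeroOneVec (hW i))
  have hmem : ∀ i, ∀ w ∈ W i, (A i).mulVec w ≤ b i ∧ (C i).mulVec w = d i := fun i w hw =>
    (hQ i).ge (subset_convexHull ℝ _ hw)
  constructor
  · rintro ⟨hA, hpos, hC, hsum⟩
    have hnonneg : ∀ i, 0 ≤ y ⟨i, none⟩ := by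
      intro i
      by_cases hi : i ∈ S
      · exact hpos i hi
      · exact nonneg_of_mulVec_le_smul (hbox i) ((hQ i).symm ▸ hS i hi) (hA i) (hC i)
    have hex : ∀ i, ∃ z ∈ convexHull ℝ (W i), blockProj i y = y ⟨i, none⟩ • z := by
      intro i
      rcases (hnonneg i).eq_or_lt with h0 | h0
      · obtain ⟨w, hw⟩ := hne i
        refine ⟨w, subset_convexHull ℝ _ hw, ?_⟩
        rw [← h0, zero_smul]
        refine eq_zero_of_mulVec_nonpos (hbox i) (hmem i w hw) ?_ ?_
        · simpa [← h0] using hA i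
        · simpa [← h0] using hC i
      · refine ⟨(y ⟨i, none⟩)⁻¹ • blockProj i y, ?_, (smul_inv_smul₀ h0.ne' _).symm⟩
        rw [← hQ i, Set.mem_ofPred_eq, Matrix.mulVec_smul, Matrix.mulVec_smul, hC i,
          inv_smul_smul₀ h0.ne']
        exact ⟨(inv_smul_le_iff_of_pos h0).2 (hA i), rfl⟩
    choose z hz hyz using hex
    rw [eq_sum_smul_blockEmbed y z hyz]
    exact (convex_convexHull ℝ _).sum_mem (fun i _ => hnonneg i) hsum
      fun i _ => blockEmbed_mem_convexHull (hz i)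
  · have hsub : convexHull ℝ (⋃ i, blockEmbed i '' W i) ⊆
        {y | (∀ i, (A i).mulVec (blockProj i y) ≤ y ⟨i, none⟩ • b i) ∧
          (∀ i ∈ S, 0 ≤ y ⟨i, none⟩) ∧
          (∀ i, (C i).mulVec (blockProj i y) = y ⟨i, none⟩ • d i) ∧
          ∑ i, y ⟨i, none⟩ = 1} := by
      refine convexHull_min ?_ ?_
      · intro y hy
        obtain ⟨i, w, hw, rfl⟩ := Set.mem_iUnion.1 hy
        refine ⟨fun j => ?_, fun j _ => (isZeroOneVec_blockEmbed (hW i w hw)).mem_Icc.1 ⟨j, none⟩,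
          fun j => ?_, ?_⟩
        · by_cases h : j = i
          · subst h
            simpa [blockProj_blockEmbed_self, blockEmbed_self] using (hmem j w hw).1
          · simp [blockProj_blockEmbed_of_ne h, blockEmbed_of_ne h]
        · by_cases h : j = i
          · subst h
            simpa [blockProj_blockEmbed_self, blockEmbed_self] using (hmem j w hw).2
          · simp [blockProj_blockEmbed_of_ne h, blockEmbed_of_ne h]
        · rw [Finset.sum_eq_single i]
          · simp [blockEmbed_self]
          · intro j _ hj
            exact blockEmbed_of_ne hj w none
          · simp
      · rintro u ⟨hu1, hu2, hu3, hu4⟩ v ⟨hv1, hv2, hv3, hv4⟩ α β hα hβ hαβ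
        refine ⟨fun i => ?_, fun i hi => ?_, fun i => ?_, ?_⟩
        · have h1 := smul_le_smul_of_nonneg_left (hu1 i) hα
          have h2 := smul_le_smul_of_nonneg_left (hv1 i) hβ
          simpa [Matrix.mulVec_add, Matrix.mulVec_smul, add_smul, mul_smul] using add_le_add h1 h2
        · have h1 := mul_nonneg hα (hu2 i hi)
          have h2 := mul_nonneg hβ (hv2 i hi)
          simpa using add_nonneg h1 h2
        · simp [Matrix.mulVec_add, Matrix.mulVec_smul, add_smul, mul_smul, hu3 i, hv3 i]
        · simp [Finset.sum_add_distrib, ← Finset.mul_sum, hu4, hv4, hαβ]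
    exact fun hy => hsub hy

lemma convexHull_iUnion_convexHull {ι E : Type*} [AddCommGroup E] [Module ℝ E]
    (V : ι → Set E) : convexHull ℝ (⋃ i, convexHull ℝ (V i)) = convexHull ℝ (⋃ i, V i) := by
  refine Set.Subset.antisymm (convexHull_min (Set.iUnion_subset fun i =>
    convexHull_mono (Set.subset_iUnion V i)) (convex_convexHull ℝ _)) ?_
  exact convexHull_mono (Set.iUnion_mono fun i => subset_convexHull ℝ (V i))

lemma HasNiceDescrOfSize.convexHull_iUnion {p k : ℕ} {P : Fin k → Set (Fin p → ℝ)}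
    {m : Fin k → ℕ} (h01 : ∀ i, IsZeroOnePolytope (P i)) (hne : ∀ i, (P i).Nonempty)
    (hdisj : ∀ i j, i ≠ j → Disjoint (P i) (P j)) (hP : ∀ i, HasNiceDescrOfSize (P i) (m i)) :
    HasNiceDescrOfSize (convexHull ℝ (⋃ i, P i))
      ((∑ i, m i) + Nat.card {i : Fin k // ∃ x, P i = {x}}) := by
  classical
  choose V hV hPV using h01
  obtain rfl : P = fun i => convexHull ℝ (V i) := funext hPV
  choose q s A b C d π hnice using hP
  choose W hW hQ using fun i => (hnice i).1
  have hbij : ∀ i, Set.BijOn (π i) (W i) (V i) := by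
    intro i
    have h := hnice i
    rw [hQ i] at h
    exact (isNiceExtension_convexHull_iff (hV i) (hW i) (π i)).1 h
  have hWne : ∀ i, (W i).Nonempty := by
    intro i
    obtain ⟨v, hv⟩ := convexHull_nonempty_iff.1 (hne i)
    obtain ⟨w, hw, -⟩ := (hbij i).surjOn hv
    exact ⟨w, hw⟩
  let S : Set (Fin k) := {i | ∃ x, convexHull ℝ (V i) = {x}}
  have hS : ∀ i ∉ S, (convexHull ℝ (W i)).Nontrivial := by
    intro i hi
    rw [← Set.not_subsingleton_iff]
    intro hsub
    refine hi (Set.exists_eq_singleton_iff_nonempty_subsingleton.2 ⟨hne i, ?_⟩)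
    rw [← (hbij i).image_eq, ← LinearMap.image_convexHull]
    exact hsub.image _
  let ht : ∀ i : Fin k, ((Σ i, Option (Fin (q i))) → ℝ) →ₗ[ℝ] ℝ := fun i =>
    LinearMap.proj ⟨i, none⟩
  have hcard : Fintype.card ((Σ i, Fin (m i)) ⊕ S) =
      (∑ i, m i) + Nat.card {i : Fin k // ∃ x, convexHull ℝ (V i) = {x}} := by
    rw [Fintype.card_sum, Fintype.card_sigma, ← Nat.card_eq_fintype_card (α := S)]
    simp only [Fintype.card_fin]
    rfl
  have hcomb : ∀ i, ∀ w, (∑ j, π j ∘ₗ blockProj j) (blockEmbed i w) = π i w := by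
    intro i w
    rw [LinearMap.sum_apply, Finset.sum_eq_single i]
    · simp [blockProj_blockEmbed_self]
    · intro j _ hj
      simp [blockProj_blockEmbed_of_ne hj]
    · simp
  rw [convexHull_iUnion_convexHull, ← hcard]
  refine HasNiceDescrOfSize.of_functionals (σ := (Σ i, Fin (m i)) ⊕ S)
    (τ := (Σ i, Fin (s i)) ⊕ Unit)
    (Sum.elim (fun x : Σ i, Fin (m i) => LinearMap.proj x.2 ∘ₗ (A x.1).mulVecLin ∘ₗ blockProj x.1
      - b x.1 x.2 • ht x.1) (fun i : S => -ht i)) 0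
    (Sum.elim (fun x : Σ i, Fin (s i) => LinearMap.proj x.2 ∘ₗ (C x.1).mulVecLin ∘ₗ blockProj x.1
      - d x.1 x.2 • ht x.1) (fun _ => ∑ i, ht i)) (Sum.elim 0 1)
    (∑ i, π i ∘ₗ blockProj i) (W := ⋃ i, blockEmbed i '' W i) ?_ ?_ ?_ ?_
  · intro x hx
    obtain ⟨i, hi⟩ := Set.mem_iUnion.1 hx
    exact hV i x hi
  · intro x hx
    obtain ⟨i, w, hw, rfl⟩ := Set.mem_iUnion.1 hx
    exact isZeroOneVec_blockEmbed (hW i w hw)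
  · ext y
    rw [← disjunctive_description hW hWne hQ S hS]
    simp [ht, Pi.le_def, funext_iff, sub_eq_zero, mul_comm, and_assoc, Sigma.forall]
  · refine ⟨?_, ?_, ?_⟩
    · intro x hx
      obtain ⟨i, w, hw, rfl⟩ := Set.mem_iUnion.1 hx
      rw [hcomb]
      exact Set.mem_iUnion.2 ⟨i, (hbij i).mapsTo hw⟩
    · intro x hx x' hx' hxx'
      obtain ⟨i, w, hw, rfl⟩ := Set.mem_iUnion.1 hx
      obtain ⟨j, w', hw', rfl⟩ := Set.mem_iUnion.1 hx'
      rw [hcomb, hcomb] at hxx'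
      by_cases h : i = j
      · subst h
        rw [(hbij i).injOn hw hw' hxx']
      · have h1 := subset_convexHull ℝ _ ((hbij i).mapsTo hw)
        have h2 := subset_convexHull ℝ _ ((hbij j).mapsTo hw')
        rw [hxx'] at h1
        exact absurd h2 (Set.disjoint_left.1 (hdisj i j h) h1)
    · intro v hv
      obtain ⟨i, hi⟩ := Set.mem_iUnion.1 hv
      obtain ⟨w, hw, rfl⟩ := (hbij i).surjOn hi
      exact ⟨blockEmbed i w, Set.mem_iUnion.2 ⟨i, w, hw, rfl⟩, hcomb i w⟩

/-- For pairwise disjoint nonempty 0/1-polytopes `P₁, …, P_k ⊆ ℝ^p`,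
`xcs(conv(P₁ ∪ ⋯ ∪ P_k)) ≤ Σᵢ xcs(Pᵢ) + #{i : Pᵢ is a singleton}`. -/
theorem stmt3 {p k : ℕ} (P : Fin k → Set (Fin p → ℝ))
    (h01 : ∀ i, IsZeroOnePolytope (P i)) (hne : ∀ i, (P i).Nonempty)
    (hdisj : ∀ i j, i ≠ j → Disjoint (P i) (P j)) :
    xcs (convexHull ℝ (⋃ i, P i)) ≤
      (∑ i, xcs (P i)) + Nat.card {i : Fin k // ∃ x, P i = {x}} :=
  Nat.sInf_le (HasNiceDescrOfSize.convexHull_iUnion h01 hne hdisj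
    fun i => (h01 i).hasNiceDescrOfSize_xcs)
end
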